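/- arXiv:2507.00941 — 7 statements merged into one kernel-verified Lean document; each statement's English description precedes it below -/
import Mathlib

section
/- For all positive integers l and k, there exists a finite connected simple graph G such that cop_l(G) - cop'_l(G) ≥ k; that is, the cost of capturing rather than merely seeing the robber with l-visibility cops can be arbitrarily large. -/
open Classical

/-- A cop at `c` sees the vertex `v` when `v` is within distance `l` of `c`. -/
def inSight {V : Type} (G : SimpleGraph V) (l : ℕ) (c v : V) : Prop :=
  G.Reachable c v ∧ G.dist c v ≤ l

/-- A legal robber trajectory: at each turn the robber stays put or moves
to an adjacent vertex. -/
def LegalRobber {V : Type} (G : SimpleGraph V) (r : ℕ → V) : Prop :=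
  ∀ t, r (t + 1) = r t ∨ G.Adj (r t) (r (t + 1))

/-- A legal sequence of cop positions: at each turn every cop stays put or
moves to an adjacent vertex. -/
def LegalCopPath {V : Type} (G : SimpleGraph V) {k : ℕ} (P : ℕ → Fin k → V) : Prop :=
  ∀ t i, P (t + 1) i = P t i ∨ G.Adj (P t i) (P (t + 1) i)

/-- The observation made by `l`-visibility cops at positions `P` when the robber
is at `rv`: they see the robber exactly when he is within distance `l` of some cop. -/
noncomputable def visObs {V : Type} (G : SimpleGraph V) (l : ℕ) {k : ℕ}
    (P : Fin k → V) (rv : V) : Option V :=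
  if ∃ i, inSight G l (P i) rv then some rv else none

/-- The play of the `l`-visibility game: given initial cop positions `init`, a cop
strategy `σ` (a function of the history of observations only), and a robber
trajectory `r`, this returns the cop positions after `t` cop moves together with the
history of observations made so far. -/
noncomputable def visPlay {V : Type} (G : SimpleGraph V) (l : ℕ) {k : ℕ}
    (init : Fin k → V) (σ : List (Option V) → Fin k → V) (r : ℕ → V) :
    ℕ → (Fin k → V) × List (Option V)
  | 0 => (init, [])
  | t + 1 =>
    let prev := visPlay G l init σ r t
    let h := prev.2 ++ [visObs G l prev.1 (r t)]
    (σ h, h)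

/-- Cop positions after `t` cop moves in the `l`-visibility game. -/
noncomputable def visPos {V : Type} (G : SimpleGraph V) (l : ℕ) {k : ℕ}
    (init : Fin k → V) (σ : List (Option V) → Fin k → V) (r : ℕ → V) (t : ℕ) :
    Fin k → V :=
  (visPlay G l init σ r t).1

/-- `k` cops with visibility `l` can guarantee capturing the robber on `G`:
there are initial positions and a strategy (depending only on the cops' observations)
whose moves are always legal and such that, against every legal robber trajectory,
some cop eventually occupies the robber's vertex. -/
def VisCopsCapture {V : Type} (G : SimpleGraph V) (l k : ℕ) : Prop :=
  ∃ (init : Fin k → V) (σ : List (Option V) → Fin k → V),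
    ∀ r : ℕ → V, LegalRobber G r →
      LegalCopPath G (visPos G l init σ r) ∧
      ∃ t i, visPos G l init σ r t i = r t ∨ visPos G l init σ r (t + 1) i = r t

/-- `k` cops with visibility `l` can guarantee seeing the robber on `G`. -/
def VisCopsSee {V : Type} (G : SimpleGraph V) (l k : ℕ) : Prop :=
  ∃ (init : Fin k → V) (σ : List (Option V) → Fin k → V),
    ∀ r : ℕ → V, LegalRobber G r →
      LegalCopPath G (visPos G l init σ r) ∧
      ∃ t i, inSight G l (visPos G l init σ r t i) (r t) ∨
        inSight G l (visPos G l init σ r (t + 1) i) (r t)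

/-- The `l`-visibility capture number `cop_l(G)`. -/
noncomputable def visCaptureNum {V : Type} (G : SimpleGraph V) (l : ℕ) : ℕ :=
  sInf {k | VisCopsCapture G l k}

/-- The `l`-visibility seeing number `cop'_l(G)`. -/
noncomputable def visSeeNum {V : Type} (G : SimpleGraph V) (l : ℕ) : ℕ :=
  sInf {k | VisCopsSee G l k}

/-- Hubs indexed by `ι`, pairwise adjacent, together with points `((j, a), y)` of `(ι × κ) × F`.
The hub `j` is adjacent to the points of class `j`, and distinct points `(x, y)`, `(x', y')` are
adjacent when `y + y' = e x * e x'`. -/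
def hubGraph {ι κ F : Type} [Field F] (e : ι × κ → F) :
    SimpleGraph (ι ⊕ ((ι × κ) × F)) where
  Adj
    | .inl a, .inl b => a ≠ b
    | .inl a, .inr d => d.1.1 = a
    | .inr d, .inl a => d.1.1 = a
    | .inr d, .inr d' => d ≠ d' ∧ d.2 + d'.2 = e d.1 * e d'.1
  symm := ⟨by
    rintro (a | d) (b | d') h
    · exact h.symm
    · exact h
    · exact h
    · exact ⟨h.1.symm, by rw [add_comm, h.2, mul_comm]⟩⟩
  loopless := ⟨by
    rintro (a | d) h
    · exact h rfl
    · exact h.1 rfl⟩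

section HubGraph

variable {ι κ F : Type} [Field F] {e : ι × κ → F}

theorem hubGraph_connected [Nonempty ι] : (hubGraph e).Connected := by
  have hub (a b : ι) : (hubGraph e).Reachable (.inl a) (.inl b) := by
    by_cases h : a = b
    · rw [h]
    · exact SimpleGraph.Adj.reachable (show (hubGraph e).Adj (.inl a) (.inl b) from h)
  obtain ⟨a⟩ := ‹Nonempty ι›
  refine SimpleGraph.connected_iff_exists_forall_reachable _ |>.2 ⟨.inl a, ?_⟩
  rintro (b | d)
  · exact hub a b
  · exact (hub a d.1.1).trans
      (SimpleGraph.Adj.reachable (show (hubGraph e).Adj (.inl d.1.1) (.inr d) from rfl))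

/-- Two distinct points have at most one common neighbour among the points, when the latter are
identified through their first coordinates. -/
theorem eq_of_common_neighbor (he : Function.Injective e) {r d : (ι × κ) × F} (hrd : d ≠ r)
    {x x' : ι × κ} (h : d.2 + (e r.1 * e x - r.2) = e d.1 * e x)
    (h' : d.2 + (e r.1 * e x' - r.2) = e d.1 * e x') : x = x' := by
  have hprod : (e d.1 - e r.1) * (e x - e x') = 0 := by linear_combination h' - h
  rcases mul_eq_zero.1 hprod with h0 | h0
  · have h1 : d.1 = r.1 := he (sub_eq_zero.1 h0)
    rw [h1] at h
    exact absurd (Prod.ext h1 (by linear_combination h)) hrd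
  · exact he (sub_eq_zero.1 h0)

/-- A robber on an unoccupied point can escape from the closed neighbourhood of few cops. -/
theorem hubGraph_exists_escape [Fintype ι] [Fintype κ] (he : Function.Injective e) {n : ℕ}
    (hι : n < Fintype.card ι) (hκ : 2 * n < Fintype.card κ)
    (P : Fin n → ι ⊕ ((ι × κ) × F)) (r : (ι × κ) × F) (hr : ∀ i, P i ≠ .inr r) :
    ∃ r', (r' = r ∨ (hubGraph e).Adj (.inr r) (.inr r')) ∧
      ∀ i, P i ≠ .inr r' ∧ ¬ (hubGraph e).Adj (P i) (.inr r') := by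
  obtain ⟨j, hj⟩ : ∃ j, ∀ i, P i ≠ .inl j := by
    by_contra! h
    choose f hf using h
    have hf' : Function.Injective f := fun a b hab => Sum.inl_injective (by rw [← hf, ← hf, hab])
    simpa using hι.trans_le (Fintype.card_le_of_injective f hf')
  by_contra! hcon
  let v (a : κ) : (ι × κ) × F := ((j, a), e r.1 * e (j, a) - r.2)
  have hv (a : κ) : v a = r ∨ (hubGraph e).Adj (.inr r) (.inr (v a)) := by
    by_cases h : v a = r
    · exact .inl h
    · exact .inr ⟨Ne.symm h, add_sub_cancel _ _⟩
  have hblock (a : κ) : ∃ s : Fin n × Bool, ∃ d, P s.1 = .inr d ∧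
      (if s.2 then d = v a else d.2 + (v a).2 = e d.1 * e (j, a)) := by
    obtain ⟨i, hi⟩ := hcon (v a) (hv a)
    by_cases h : P i = .inr (v a)
    · exact ⟨(i, true), v a, h, by simp⟩
    · have hadj := hi h
      rcases hP : P i with b | d
      · rw [hP] at hadj
        have hb : j = b := hadj
        exact absurd (hb ▸ hP) (hj i)
      · rw [hP] at hadj
        exact ⟨(i, false), d, hP, by simpa using hadj.2⟩
  choose f hf using hblock
  have hinj : Function.Injective f := by
    intro a b hab
    obtain ⟨d, hd, ha⟩ := hf a
    obtain ⟨d', hd', hb⟩ := hf b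
    rw [← hab] at hd' hb
    obtain rfl : d = d' := Sum.inr_injective (hd.symm.trans hd')
    have hdr : d ≠ r := fun h => hr (f a).1 (h ▸ hd)
    cases h2 : (f a).2
    · simp only [h2, Bool.false_eq_true, if_false] at ha hb
      exact congrArg Prod.snd (eq_of_common_neighbor he hdr ha hb)
    · simp only [h2, if_true] at ha hb
      exact congrArg (fun z => z.1.2) (ha.symm.trans hb)
  have hcard := Fintype.card_le_of_injective f hinj
  simp only [Fintype.card_prod, Fintype.card_fin, Fintype.card_bool] at hcard
  omega

end HubGraph

/-- A robber who, from every unoccupied vertex of a set `S`, can move within `S` out of the closed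
neighbourhood of any `n` cops is never captured by `n` cops, whatever their visibility. -/
theorem not_visCopsCapture_of_escape {V : Type} {G : SimpleGraph V} {l n : ℕ} {S : Set V}
    (hstart : ∀ P : Fin n → V, ∃ r ∈ S, ∀ i, P i ≠ r)
    (hstep : ∀ (P : Fin n → V), ∀ r ∈ S, (∀ i, P i ≠ r) →
      ∃ r' ∈ S, (r' = r ∨ G.Adj r r') ∧ ∀ i, P i ≠ r' ∧ ¬ G.Adj (P i) r') :
    ¬ VisCopsCapture G l n := by
  rintro ⟨init, σ, hσ⟩
  have hnext (P : Fin n → V) (r : V) : ∃ r', (r' = r ∨ G.Adj r r') ∧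
      (r ∈ S → (∀ i, P i ≠ r) → r' ∈ S ∧ ∀ i, P i ≠ r' ∧ ¬ G.Adj (P i) r') := by
    by_cases h : r ∈ S ∧ ∀ i, P i ≠ r
    · obtain ⟨r', h1, h2, h3⟩ := hstep P r h.1 h.2
      exact ⟨r', h2, fun _ _ => ⟨h1, h3⟩⟩
    · exact ⟨r, .inl rfl, fun h1 h2 => absurd ⟨h1, h2⟩ h⟩
  choose next hlegal hsafe using hnext
  obtain ⟨r₀, hr₀, hfree⟩ := hstart init
  let step (s : ((Fin n → V) × List (Option V)) × V) : ((Fin n → V) × List (Option V)) × V :=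
    let h := s.1.2 ++ [visObs G l s.1.1 s.2]
    ((σ h, h), next (σ h) s.2)
  let state : ℕ → ((Fin n → V) × List (Option V)) × V :=
    Nat.rec ((init, []), next init r₀) fun _ s => step s
  let r : ℕ → V := fun t => (state t).2
  have hplay (t : ℕ) : visPlay G l init σ r t = (state t).1 := by
    induction t with
    | zero => rfl
    | succ t ih =>
      rw [visPlay, ih]
  have hpos (t : ℕ) : visPos G l init σ r t = (state t).1.1 := congrArg Prod.fst (hplay t)
  have hr (t : ℕ) : r (t + 1) = next (visPos G l init σ r (t + 1)) (r t) := by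
    rw [hpos]
  have hrobber : LegalRobber G r := fun t => by
    rw [hr]
    exact hlegal _ _
  obtain ⟨hcop, t, i, hcap⟩ := hσ r hrobber
  have hunocc (t : ℕ) (h : ∀ i, visPos G l init σ r t i ≠ r t ∧
      ¬ G.Adj (visPos G l init σ r t i) (r t)) (i : Fin n) :
      visPos G l init σ r (t + 1) i ≠ r t := by
    intro h'
    rcases hcop t i with h1 | h1
    · exact (h i).1 (h1.symm.trans h')
    · exact (h i).2 (h' ▸ h1)
  have hinv (t : ℕ) : r t ∈ S ∧ ∀ i, visPos G l init σ r t i ≠ r t ∧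
      ¬ G.Adj (visPos G l init σ r t i) (r t) := by
    induction t with
    | zero => exact hsafe init r₀ hr₀ hfree
    | succ t ih =>
      rw [hr]
      exact hsafe _ _ ih.1 (hunocc t ih.2)
  rcases hcap with h | h
  · exact ((hinv t).2 i).1 h
  · exact hunocc t (hinv t).2 i h

theorem visCopsCapture_card {V : Type} [Fintype V] (G : SimpleGraph V) (l : ℕ) :
    VisCopsCapture G l (Fintype.card V) := by
  let f := (Fintype.equivFin V).symm
  refine ⟨f, fun _ => f, fun r _ => ⟨fun t i => .inl ?_, 0, f.symm (r 0), .inl ?_⟩⟩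
  · cases t <;> rfl
  · exact f.apply_symm_apply _

/-- One cop per pair of adjacent hubs sees the robber by walking from one hub to the other. -/
theorem hubGraph_visCopsSee {κ F : Type} [Field F] {k l : ℕ} (e : (Fin k × Bool) × κ → F)
    (hl : 0 < l) : VisCopsSee (hubGraph e) l k := by
  refine ⟨fun i => .inl (i, false), fun h i => .inl (i, h.length.bodd), fun r _ => ?_⟩
  have hlen (t : ℕ) : (visPlay (hubGraph e) l (fun i => .inl (i, false))
      (fun h i => .inl (i, h.length.bodd)) r t).2.length = t := by
    induction t with
    | zero => rfl
    | succ t ih => simp [visPlay, ih]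
  have hpos (t : ℕ) (i : Fin k) : visPos (hubGraph e) l (fun i => .inl (i, false))
      (fun h i => .inl (i, h.length.bodd)) r t i = .inl (i, t.bodd) := by
    cases t with
    | zero => rfl
    | succ t => simp [visPos, visPlay, hlen]
  have hsee (a : Fin k × Bool) (v) (h : v = .inl a ∨ (hubGraph e).Adj (.inl a) v) :
      inSight (hubGraph e) l (.inl a) v := by
    rcases h with rfl | h
    · exact ⟨.rfl, by simp⟩
    · exact ⟨h.reachable, (SimpleGraph.dist_eq_one_iff_adj.2 h).trans_le hl⟩
  have hdom (v) : ∃ a, v = .inl a ∨ (hubGraph e).Adj (.inl a) v := by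
    rcases v with a | d
    · exact ⟨a, .inl rfl⟩
    · exact ⟨d.1.1, .inr rfl⟩
  refine ⟨fun t i => .inr ?_, 0, ?_⟩
  · rw [hpos, hpos]
    change (i, t.bodd) ≠ (i, (t + 1).bodd)
    simp
  · obtain ⟨⟨i, b⟩, h⟩ := hdom (r 0)
    refine ⟨i, ?_⟩
    rw [hpos, hpos]
    cases b
    · exact .inl (hsee _ _ h)
    · exact .inr (hsee _ _ h)

/-- For all positive integers `l` and `k`, there exists a finite
connected simple graph `G` such that `cop_l(G) - cop'_l(G) ≥ k`: the cost of
capturing rather than merely seeing the robber with `l`-visibility cops can be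
arbitrarily large. -/
theorem cost_of_capture_arbitrarily_large (l k : ℕ) (hl : 0 < l) (hk : 0 < k) :
    ∃ (V : Type) (_ : Fintype V) (G : SimpleGraph V),
      G.Connected ∧ visSeeNum G l + k ≤ visCaptureNum G l := by
  obtain ⟨p, hp, hprime⟩ := Nat.exists_infinite_primes (Fintype.card ((Fin k × Bool) × Fin (4 * k)))
  have : Fact p.Prime := ⟨hprime⟩
  obtain ⟨e⟩ : Nonempty ((Fin k × Bool) × Fin (4 * k) ↪ ZMod p) :=
    Function.Embedding.nonempty_of_card_le (by rwa [ZMod.card])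
  have : Nonempty (Fin k × Bool) := ⟨(⟨0, hk⟩, false)⟩
  refine ⟨_, inferInstance, hubGraph e, hubGraph_connected, ?_⟩
  have hsee : visSeeNum (hubGraph e) l ≤ k := Nat.sInf_le (hubGraph_visCopsSee e hl)
  have hcap : 2 * k ≤ visCaptureNum (hubGraph e) l := by
    refine le_csInf ⟨_, visCopsCapture_card _ _⟩ fun n hn => ?_
    by_contra! hlt
    refine not_visCopsCapture_of_escape (S := Set.range Sum.inr) (fun P => ?_) ?_ hn
    · by_contra! h
      have h' (a : Fin (4 * k)) : ∃ i, P i = .inr (((⟨0, hk⟩, false), a), 0) := h _ ⟨_, rfl⟩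
      choose f hf using h'
      have hinj : Function.Injective f := fun a b hab => by
        have := (hf a).symm.trans (hab ▸ hf b)
        simpa using this
      have := Fintype.card_le_of_injective f hinj
      simp only [Fintype.card_fin] at this
      omega
    · rintro P _ ⟨r, rfl⟩ hfree
      obtain ⟨r', h1, h2⟩ := hubGraph_exists_escape e.injective
        (by simp; omega) (by simp; omega) P r hfree
      exact ⟨.inr r', ⟨r', rfl⟩, h1.imp_left (congrArg _), h2⟩
  omega
end

section
/- For every positive integer l, every finite connected simple graph G, and all non-negative integers r ≤ s, the inference numbers satisfy ded^r_l(G) ≤ ded^s_l(G) + (s - r). -/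
open Classical

/-- The set of vertices not in the closed `l`-neighbourhood of any of the
cleaners at positions `P`. -/
def unseen {V : Type} (G : SimpleGraph V) (l : ℕ) {k : ℕ} (P : Fin k → V) : Set V :=
  {v | ∀ i, ¬ inSight G l (P i) v}

/-- One round of the cleaning process, performed with the cleaners standing at their
new positions `P`: first every vertex within distance `l` of a cleaner is cleaned,
and then the gas spreads from the remaining gaseous vertices to every adjacent
vertex that is not within distance `l` of a cleaner. -/
def gasStep {V : Type} (G : SimpleGraph V) (l : ℕ) {k : ℕ} (P : Fin k → V)
    (S : Set V) : Set V :=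
  (S ∩ unseen G l P) ∪ {v ∈ unseen G l P | ∃ u ∈ S ∩ unseen G l P, G.Adj u v}

/-- A legal sequence of cleaner positions: at each timestep every cleaner stays put
or moves to an adjacent vertex. -/
def ValidMoves {V : Type} (G : SimpleGraph V) {k : ℕ} (pos : ℕ → Fin k → V) : Prop :=
  ∀ t i, pos (t + 1) i = pos t i ∨ G.Adj (pos t i) (pos (t + 1) i)

/-- The set of gaseous vertices after `t` full rounds (move, clean, spread) of the
cleaning process with `l`-visibility cleaners following the position sequence `pos`.
Initially every vertex not within distance `l` of a cleaner is gaseous. -/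
def gasSeq {V : Type} (G : SimpleGraph V) (l : ℕ) {k : ℕ} (pos : ℕ → Fin k → V) :
    ℕ → Set V
  | 0 => unseen G l (pos 0)
  | t + 1 => gasStep G l (pos (t + 1)) (gasSeq G l pos t)

/-- The set of gaseous vertices in round `t + 1` at the intermediate moment after the
cleaners have moved and cleaned, but before the gas spreads. -/
def gasMid {V : Type} (G : SimpleGraph V) (l : ℕ) {k : ℕ} (pos : ℕ → Fin k → V)
    (t : ℕ) : Set V :=
  gasSeq G l pos t ∩ unseen G l (pos (t + 1))

/-- `k` cleaners with `l`-visibility have a strategy such that at some point during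
the cleaning process on `G` at most `r` vertices are gaseous. -/
def CanCleanDownTo {V : Type} (G : SimpleGraph V) (l k r : ℕ) : Prop :=
  ∃ pos : ℕ → Fin k → V, ValidMoves G pos ∧
    ∃ t, (gasSeq G l pos t).ncard ≤ r ∨ (gasMid G l pos t).ncard ≤ r

/-- The `(r, l)`-inference number `ded^r_l(G)`: the minimum number of cleaners with
`l`-visibility that can reach a state of the cleaning process with at most `r`
gaseous vertices. -/
noncomputable def dedNum {V : Type} (G : SimpleGraph V) (r l : ℕ) : ℕ :=
  sInf {k | CanCleanDownTo G l k r}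

/-- `k` cleaners with `l`-visibility have a strategy cleaning `G` of all gas. -/
def CanCleanAll {V : Type} (G : SimpleGraph V) (l k : ℕ) : Prop :=
  ∃ pos : ℕ → Fin k → V, ValidMoves G pos ∧
    ∃ t, gasSeq G l pos t = ∅ ∨ gasMid G l pos t = ∅

/-- The `l`-visibility seeing number `cop'_l(G)`: the minimum number of cleaners with
`l`-visibility that can clean `G` of all gas. -/
noncomputable def seeNum {V : Type} (G : SimpleGraph V) (l : ℕ) : ℕ :=
  sInf {k | CanCleanAll G l k}

/-- `k` cleaners with `l`-visibility have a strategy such that at some point during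
the cleaning process on `G` at least `N` vertices are clean (a vertex being clean
precisely when it is not gaseous). -/
def CanCleanAtLeast {V : Type} (G : SimpleGraph V) (l k N : ℕ) : Prop :=
  ∃ pos : ℕ → Fin k → V, ValidMoves G pos ∧
    ∃ t, N ≤ ((gasSeq G l pos t)ᶜ).ncard ∨ N ≤ ((gasMid G l pos t)ᶜ).ncard

/-- `Δ_l(H)`: the maximum over the vertices `v` of `H` of the number of vertices
distinct from `v` at distance at most `l` from `v`. -/
noncomputable def maxBall {W : Type} (H : SimpleGraph W) (l : ℕ) : ℕ :=
  ⨆ v : W, {u | u ≠ v ∧ H.Reachable v u ∧ H.dist v u ≤ l}.ncard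

theorem inSight_self {V : Type} (G : SimpleGraph V) (l : ℕ) (v : V) : inSight G l v v :=
  ⟨SimpleGraph.Reachable.refl v, by simp⟩

theorem unseen_cons_subset {V : Type} (G : SimpleGraph V) (l : ℕ) {k : ℕ} (v : V)
    (P : Fin k → V) :
    unseen G l (Fin.cons v P : Fin (k + 1) → V) ⊆ unseen G l P \ {v} := by
  intro u hu
  refine ⟨fun i => by simpa using hu i.succ, ?_⟩
  rintro rfl
  exact hu 0 (by simpa using inSight_self G l u)

theorem unseen_cons_subset_unseen {V : Type} (G : SimpleGraph V) (l : ℕ) {k : ℕ} (v : V)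
    (P : Fin k → V) :
    unseen G l (Fin.cons v P : Fin (k + 1) → V) ⊆ unseen G l P :=
  (unseen_cons_subset G l v P).trans Set.sdiff_subset

theorem gasStep_mono {V : Type} (G : SimpleGraph V) (l : ℕ) {k m : ℕ} {P : Fin k → V}
    {Q : Fin m → V} {S T : Set V} (hPQ : unseen G l P ⊆ unseen G l Q) (hST : S ⊆ T) :
    gasStep G l P S ⊆ gasStep G l Q T := by
  rintro v (⟨hS, hP⟩ | ⟨hP, u, ⟨hS, hu⟩, huv⟩)
  · exact Or.inl ⟨hST hS, hPQ hP⟩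
  · exact Or.inr ⟨hPQ hP, u, ⟨hST hS, hPQ hu⟩, huv⟩

theorem gasSeq_subset_unseen {V : Type} (G : SimpleGraph V) (l : ℕ) {k : ℕ}
    (pos : ℕ → Fin k → V) (t : ℕ) : gasSeq G l pos t ⊆ unseen G l (pos t) := by
  cases t with
  | zero => exact subset_rfl
  | succ t => exact Set.union_subset Set.inter_subset_right (Set.sep_subset _ _)

theorem gasSeq_mono {V : Type} (G : SimpleGraph V) (l : ℕ) {k m : ℕ}
    {pos : ℕ → Fin k → V} {pos' : ℕ → Fin m → V}
    (h : ∀ t, unseen G l (pos t) ⊆ unseen G l (pos' t)) (t : ℕ) :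
    gasSeq G l pos t ⊆ gasSeq G l pos' t := by
  induction t with
  | zero => exact h 0
  | succ t ih => exact gasStep_mono G l (h (t + 1)) ih

theorem gasSeq_cons_subset {V : Type} (G : SimpleGraph V) (l : ℕ) {k : ℕ}
    (pos : ℕ → Fin k → V) (v : V) (t : ℕ) :
    gasSeq G l (fun n => (Fin.cons v (pos n) : Fin (k + 1) → V)) t
      ⊆ gasSeq G l pos t \ {v} := fun _ hu =>
  ⟨gasSeq_mono G l (fun n => unseen_cons_subset_unseen G l v (pos n)) t hu,
    (unseen_cons_subset G l v (pos t) (gasSeq_subset_unseen G l _ t hu)).2⟩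

theorem gasMid_cons_subset {V : Type} (G : SimpleGraph V) (l : ℕ) {k : ℕ}
    (pos : ℕ → Fin k → V) (v : V) (t : ℕ) :
    gasMid G l (fun n => (Fin.cons v (pos n) : Fin (k + 1) → V)) t
      ⊆ gasMid G l pos t \ {v} := fun _ hu =>
  ⟨⟨(gasSeq_cons_subset G l pos v t hu.1).1, (unseen_cons_subset G l v _ hu.2).1⟩,
    (unseen_cons_subset G l v _ hu.2).2⟩

theorem ValidMoves.cons {V : Type} {G : SimpleGraph V} {k : ℕ} {pos : ℕ → Fin k → V}
    (h : ValidMoves G pos) (v : V) :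
    ValidMoves G (fun n => (Fin.cons v (pos n) : Fin (k + 1) → V)) := by
  intro t i
  cases i using Fin.cases with
  | zero => simp
  | succ i => simpa using h t i

theorem exists_ncard_sdiff_singleton_le {V : Type} [Finite V] [Nonempty V] {A : Set V} {r : ℕ}
    (hA : A.ncard ≤ r + 1) : ∃ v, (A \ {v}).ncard ≤ r := by
  rcases A.eq_empty_or_nonempty with rfl | ⟨v, hv⟩
  · exact ⟨Classical.arbitrary V, by simp⟩
  · exact ⟨v, by rw [Set.ncard_sdiff_singleton_of_mem hv]; omega⟩

theorem CanCleanDownTo.succ {V : Type} [Finite V] [Nonempty V] {G : SimpleGraph V} {l k r : ℕ}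
    (h : CanCleanDownTo G l k (r + 1)) : CanCleanDownTo G l (k + 1) r := by
  obtain ⟨pos, hpos, t, ht | ht⟩ := h
  · obtain ⟨v, hv⟩ := exists_ncard_sdiff_singleton_le ht
    exact ⟨_, hpos.cons v, t, Or.inl
      ((Set.ncard_le_ncard (gasSeq_cons_subset G l pos v t)).trans hv)⟩
  · obtain ⟨v, hv⟩ := exists_ncard_sdiff_singleton_le ht
    exact ⟨_, hpos.cons v, t, Or.inr
      ((Set.ncard_le_ncard (gasMid_cons_subset G l pos v t)).trans hv)⟩

theorem CanCleanDownTo.add {V : Type} [Finite V] [Nonempty V] {G : SimpleGraph V} {l k r d : ℕ}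
    (h : CanCleanDownTo G l k (r + d)) : CanCleanDownTo G l (k + d) r := by
  induction d generalizing k with
  | zero => exact h
  | succ d ih =>
    rw [show k + (d + 1) = k + 1 + d by omega]
    exact ih h.succ

theorem canCleanDownTo_card {V : Type} [Fintype V] (G : SimpleGraph V) (l r : ℕ) :
    CanCleanDownTo G l (Fintype.card V) r := by
  refine ⟨fun _ => (Fintype.equivFin V).symm, fun _ _ => Or.inl rfl, 0, Or.inl ?_⟩
  have h : unseen G l (Fintype.equivFin V).symm = ∅ :=
    Set.eq_empty_of_forall_notMem fun v hv =>
      hv (Fintype.equivFin V v) (by simpa using inSight_self G l v)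
  simp [gasSeq, h]

/-- For every positive integer `l`, every finite connected simple
graph `G`, and all non-negative integers `r ≤ s`, the inference numbers satisfy
`ded^r_l(G) ≤ ded^s_l(G) + (s - r)`. -/
theorem inference_number_monotone {V : Type} [Fintype V] (G : SimpleGraph V)
    (hG : G.Connected) (l : ℕ) (hl : 0 < l) (r s : ℕ) (hrs : r ≤ s) :
    dedNum G r l ≤ dedNum G s l + (s - r) := by
  have := hG.nonempty
  have h : CanCleanDownTo G l (dedNum G s l) s :=
    Nat.sInf_mem (s := {k | CanCleanDownTo G l k s}) ⟨_, canCleanDownTo_card G l s⟩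
  refine Nat.sInf_le (CanCleanDownTo.add ?_)
  rwa [Nat.add_sub_cancel' hrs]
end

section
/- For the cycle C_5 on five vertices, cop'_1(C_5) = 2 and ded^1_1(C_5) = 1; that is, two 1-visibility cleaners are needed to clean C_5 completely, but a single 1-visibility cleaner can reach a state with exactly one gaseous vertex. -/
open Classical

theorem inSight_one_iff {V : Type} (G : SimpleGraph V) (c v : V) :
    inSight G 1 c v ↔ c = v ∨ G.Adj c v := by
  constructor
  · rintro ⟨hr, hd⟩
    rcases Nat.le_one_iff_eq_zero_or_eq_one.mp hd with h | h
    · exact Or.inl (hr.dist_eq_zero_iff.mp h)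
    · exact Or.inr (SimpleGraph.dist_eq_one_iff_adj.mp h)
  · rintro (rfl | h)
    · exact ⟨SimpleGraph.Reachable.refl _, by simp⟩
    · exact ⟨h.reachable, (SimpleGraph.dist_eq_one_iff_adj.mpr h).le⟩

theorem mem_unseen_one_iff {V : Type} (G : SimpleGraph V) {k : ℕ} (P : Fin k → V) (v : V) :
    v ∈ unseen G 1 P ↔ ∀ i, ¬ (P i = v ∨ G.Adj (P i) v) := by
  simp only [unseen, Set.mem_ofPred_eq, inSight_one_iff]

theorem gasSeq_no_cleaners {V : Type} (G : SimpleGraph V) (l : ℕ) (pos : ℕ → Fin 0 → V)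
    (t : ℕ) : gasSeq G l pos t = Set.univ := by
  induction t with
  | zero => simp [gasSeq, unseen]
  | succ t ih => simp [gasSeq, gasStep, ih, unseen]

theorem gasMid_no_cleaners {V : Type} (G : SimpleGraph V) (l : ℕ) (pos : ℕ → Fin 0 → V)
    (t : ℕ) : gasMid G l pos t = Set.univ := by
  simp [gasMid, gasSeq_no_cleaners, unseen]

theorem not_canCleanDownTo_zero {V : Type} (G : SimpleGraph V) {l r : ℕ}
    (hr : r < Nat.card V) : ¬ CanCleanDownTo G l 0 r := by
  rintro ⟨pos, -, t, h⟩
  rw [gasSeq_no_cleaners, gasMid_no_cleaners, or_self, Set.ncard_univ] at h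
  omega

theorem not_canCleanAll_zero {V : Type} [Nonempty V] (G : SimpleGraph V) (l : ℕ) :
    ¬ CanCleanAll G l 0 := by
  rintro ⟨pos, -, t, h⟩
  rw [gasSeq_no_cleaners, gasMid_no_cleaners, or_self] at h
  exact Set.univ_nonempty.ne_empty h

/-- After a move of a single cleaner on `C₅` from `c` to `d`, some vertex is unseen both before
and after, and every vertex that is unseen afterwards is such a vertex or adjacent to one. -/
theorem cycleGraph_five_move (c d : Fin 5)
    (h : d = c ∨ (SimpleGraph.cycleGraph 5).Adj c d) :
    (∃ u, ¬ (c = u ∨ (SimpleGraph.cycleGraph 5).Adj c u) ∧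
      ¬ (d = u ∨ (SimpleGraph.cycleGraph 5).Adj d u)) ∧
    ∀ v, ¬ (d = v ∨ (SimpleGraph.cycleGraph 5).Adj d v) →
      ¬ (c = v ∨ (SimpleGraph.cycleGraph 5).Adj c v) ∨
      ∃ u, (¬ (c = u ∨ (SimpleGraph.cycleGraph 5).Adj c u) ∧
        ¬ (d = u ∨ (SimpleGraph.cycleGraph 5).Adj d u)) ∧
        (SimpleGraph.cycleGraph 5).Adj u v := by
  simp only [SimpleGraph.cycleGraph_adj] at *
  revert c d
  decide

theorem gasSeq_cycleGraph_five {pos : ℕ → Fin 1 → Fin 5}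
    (hpos : ValidMoves (SimpleGraph.cycleGraph 5) pos) (t : ℕ) :
    gasSeq (SimpleGraph.cycleGraph 5) 1 pos t =
      unseen (SimpleGraph.cycleGraph 5) 1 (pos t) := by
  induction t with
  | zero => rfl
  | succ t ih =>
    have hm := (cycleGraph_five_move _ _ (hpos t 0)).2
    rw [gasSeq, ih]
    ext v
    simp only [gasStep, Set.mem_union, Set.mem_inter_iff, Set.mem_ofPred_eq, mem_unseen_one_iff,
      Fin.forall_fin_one]
    constructor
    · rintro (h | h)
      · exact h.2
      · exact h.1
    · intro h
      rcases hm v h with h' | h'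
      · exact Or.inl ⟨h', h⟩
      · exact Or.inr ⟨h, h'⟩

theorem not_canCleanAll_one_cycleGraph_five :
    ¬ CanCleanAll (SimpleGraph.cycleGraph 5) 1 1 := by
  rintro ⟨pos, hpos, t, h⟩
  obtain ⟨u, hu, hu'⟩ := (cycleGraph_five_move _ _ (hpos t 0)).1
  have hc : u ∈ unseen (SimpleGraph.cycleGraph 5) 1 (pos t) := by
    simpa only [mem_unseen_one_iff, Fin.forall_fin_one] using hu
  have hd : u ∈ unseen (SimpleGraph.cycleGraph 5) 1 (pos (t + 1)) := by
    simpa only [mem_unseen_one_iff, Fin.forall_fin_one] using hu'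
  rw [gasMid, gasSeq_cycleGraph_five hpos] at h
  rcases h with h | h
  · exact Set.notMem_empty u (h ▸ hc)
  · exact Set.notMem_empty u (h ▸ ⟨hc, hd⟩)

theorem canCleanAll_two_cycleGraph_five : CanCleanAll (SimpleGraph.cycleGraph 5) 1 2 := by
  refine ⟨fun _ => ![0, 2], fun _ _ => Or.inl rfl, 0, Or.inl ?_⟩
  rw [gasSeq, Set.eq_empty_iff_forall_notMem]
  intro v
  rw [mem_unseen_one_iff]
  simp only [SimpleGraph.cycleGraph_adj]
  revert v
  decide

theorem canCleanDownTo_one_cycleGraph_five :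
    CanCleanDownTo (SimpleGraph.cycleGraph 5) 1 1 1 := by
  refine ⟨fun t _ => if t = 0 then 0 else 1, ?_, 0, Or.inr ?_⟩
  · rintro (_ | t) i
    · right
      simp [SimpleGraph.cycleGraph_adj]
    · left
      simp
  · refine (Set.ncard_le_ncard (t := {3}) ?_).trans (Set.ncard_singleton _).le
    rintro v ⟨h₁, h₂⟩
    rw [gasSeq, mem_unseen_one_iff] at h₁
    rw [mem_unseen_one_iff] at h₂
    simp only [SimpleGraph.cycleGraph_adj, Fin.forall_fin_one] at h₁ h₂
    rw [Set.mem_singleton_iff]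
    revert v
    decide

/-- For the cycle `C₅` on five vertices, `cop'_1(C₅) = 2` and
`ded^1_1(C₅) = 1`: two `1`-visibility cleaners are needed to clean `C₅` completely,
but a single `1`-visibility cleaner can reach a state with exactly one gaseous
vertex. -/
theorem c5_seeNum_two_dedNum_one :
    seeNum (SimpleGraph.cycleGraph 5) 1 = 2 ∧
    dedNum (SimpleGraph.cycleGraph 5) 1 1 = 1 := by
  constructor
  · refine le_antisymm (Nat.sInf_le canCleanAll_two_cycleGraph_five)
      (le_csInf ⟨2, canCleanAll_two_cycleGraph_five⟩ ?_)
    rintro k hk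
    by_contra! hlt
    interval_cases k
    · exact not_canCleanAll_zero _ _ hk
    · exact not_canCleanAll_one_cycleGraph_five hk
  · refine le_antisymm (Nat.sInf_le canCleanDownTo_one_cycleGraph_five)
      (le_csInf ⟨1, canCleanDownTo_one_cycleGraph_five⟩ ?_)
    rintro k hk
    by_contra! hlt
    interval_cases k
    exact not_canCleanDownTo_zero _ (by simp) hk
end

section
/- Let l and k be positive integers and let G be a finite simple graph containing k pairwise vertex-disjoint connected subgraphs G_1, …, G_k, where each G_i has at least Δ_l(G_i) + 2 vertices (Δ_l(G_i) computed within G_i). Then k cleaners with l-visibility have a strategy such that at some point during the graph cleaning process on G at least (Σ_{i=1}^k Δ_l(G_i)) + 2k vertices are clean. -/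
open Classical

lemma inSight_iff_exists_walk {V : Type} {G : SimpleGraph V} {l : ℕ} {c v : V} :
    inSight G l c v ↔ ∃ p : G.Walk c v, p.length ≤ l := by
  constructor
  · rintro ⟨hr, hd⟩
    obtain ⟨p, hp⟩ := hr.exists_walk_length_eq_dist
    exact ⟨p, hp ▸ hd⟩
  · rintro ⟨p, hp⟩
    exact ⟨p.reachable, (SimpleGraph.dist_le p).trans hp⟩

lemma inSight.map {V W : Type} {G : SimpleGraph V} {K : SimpleGraph W} {l : ℕ} {c v : W}
    (h : inSight K l c v) (f : K →g G) : inSight G l (f c) (f v) := by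
  obtain ⟨p, hp⟩ := inSight_iff_exists_walk.1 h
  exact inSight_iff_exists_walk.2 ⟨p.map f, by simpa using hp⟩

/-- If a cleaner on a connected graph does not see everything, then a single move
reveals a vertex that was out of sight. -/
lemma exists_adj_inSight_of_not_inSight {W : Type} {K : SimpleGraph W} (hK : K.Connected)
    {l : ℕ} {v x : W} (hx : ¬ inSight K l v x) :
    ∃ v' w, K.Adj v v' ∧ ¬ inSight K l v w ∧ inSight K l v' w := by
  have hlt : l < K.dist v x := by
    by_contra h
    exact hx ⟨hK v x, by omega⟩
  obtain ⟨p, hp⟩ := hK.exists_walk_length_eq_dist v x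
  have hw : ¬ inSight K l v (p.getVert (l + 1)) := by
    rintro ⟨-, hd⟩
    have h1 := hK.dist_triangle (u := v) (v := p.getVert (l + 1)) (w := x)
    have h2 := SimpleGraph.dist_le (p.drop (l + 1))
    rw [SimpleGraph.Walk.drop_length] at h2
    omega
  have hlen : (p.take (l + 1)).length = l + 1 := by
    rw [SimpleGraph.Walk.take_length]
    omega
  generalize p.take (l + 1) = q at hlen
  generalize p.getVert (l + 1) = w at hw q
  cases q with
  | nil => simp at hlen
  | cons h q =>
    refine ⟨_, w, h, hw, inSight_iff_exists_walk.2 ⟨q, ?_⟩⟩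
    simpa using hlen.le

lemma exists_ncard_inSight_eq_maxBall_add_one {W : Type} [Finite W] [Nonempty W]
    (K : SimpleGraph W) (l : ℕ) : ∃ v, {u | inSight K l v u}.ncard = maxBall K l + 1 := by
  obtain ⟨v, hv⟩ := exists_eq_ciSup_of_finite
    (f := fun v : W => {u | u ≠ v ∧ K.Reachable v u ∧ K.dist v u ≤ l}.ncard)
  refine ⟨v, ?_⟩
  rw [maxBall, ← hv, ← Set.ncard_insert_of_notMem (a := v) (by simp) (Set.toFinite _)]
  congr 1
  ext u
  by_cases h : u = v
  · subst h
    simp [inSight]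
  · simp [inSight, h]

lemma exists_move_maxBall_add_two_le {W : Type} [Finite W] {K : SimpleGraph W}
    (hK : K.Connected) (l : ℕ) (hbig : maxBall K l + 2 ≤ Nat.card W) :
    ∃ v v', K.Adj v v' ∧
      maxBall K l + 2 ≤ {u | inSight K l v u ∨ inSight K l v' u}.ncard := by
  have := hK.nonempty
  obtain ⟨v, hv⟩ := exists_ncard_inSight_eq_maxBall_add_one K l
  obtain ⟨x, hx⟩ : ∃ x, ¬ inSight K l v x := by
    by_contra! h
    rw [Set.eq_univ_of_forall (s := {u | inSight K l v u}) h, Set.ncard_univ] at hv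
    omega
  obtain ⟨v', w, hadj, hw, hw'⟩ := exists_adj_inSight_of_not_inSight hK hx
  refine ⟨v, v', hadj, ?_⟩
  have hins : (insert w {u | inSight K l v u}).ncard = maxBall K l + 2 := by
    rw [Set.ncard_insert_of_notMem (s := {u | inSight K l v u}) hw (Set.toFinite _), hv]
  rw [← hins]
  refine Set.ncard_le_ncard ?_ (Set.toFinite _)
  rintro u (rfl | hu)
  exacts [Or.inr hw', Or.inl hu]

/-- Let `l` and `k` be positive integers and let `G` be a finite
simple graph containing `k` pairwise vertex-disjoint connected subgraphs
`G_1, …, G_k`, where each `G_i` has at least `Δ_l(G_i) + 2` vertices (`Δ_l(G_i)`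
computed within `G_i`). Then `k` cleaners with `l`-visibility can reach a state of
the cleaning process on `G` with at least `(Σ_i Δ_l(G_i)) + 2k` clean vertices. -/
theorem cleaners_on_disjoint_subgraphs {V : Type} [Fintype V] (G : SimpleGraph V)
    (l k : ℕ) (hl : 0 < l) (hk : 0 < k) (H : Fin k → G.Subgraph)
    (hdisj : ∀ i j, i ≠ j → Disjoint (H i).verts (H j).verts)
    (hconn : ∀ i, (H i).Connected)
    (hbig : ∀ i, maxBall (H i).coe l + 2 ≤ (H i).verts.ncard) :
    CanCleanAtLeast G l k ((∑ i, maxBall (H i).coe l) + 2 * k) := by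
  have hmove := fun i => exists_move_maxBall_add_two_le (hconn i).coe l
    (by simpa only [Nat.card_coe_set_eq] using hbig i)
  choose v v' hadj hcard using hmove
  let S : Fin k → Set V := fun i =>
    (H i).hom '' {u | inSight (H i).coe l (v i) u ∨ inSight (H i).coe l (v' i) u}
  have hSdisj : Pairwise (Function.onFun Disjoint S) := by
    intro i j hij
    refine (hdisj i j hij).mono ?_ ?_ <;>
    · rintro _ ⟨u, -, rfl⟩
      exact u.2
  let pos : ℕ → Fin k → V := fun t i => if t = 0 then v i else v' i
  refine ⟨pos, ?_, 0, Or.inr ?_⟩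
  · rintro (_ | t) i
    · exact Or.inr ((H i).coe_adj_sub _ _ (hadj i))
    · exact Or.inl rfl
  · calc (∑ i, maxBall (H i).coe l) + 2 * k
        = ∑ i, (maxBall (H i).coe l + 2) := by
          simp [Finset.sum_add_distrib, mul_comm]
      _ ≤ ∑ i, (S i).ncard := by
          refine Finset.sum_le_sum fun i _ => ?_
          rw [Set.ncard_image_of_injective _ (H i).hom_injective]
          exact hcard i
      _ = (⋃ i, S i).ncard := by
          rw [Set.ncard_iUnion_of_finite (fun _ => Set.toFinite _) hSdisj,
            finsum_eq_sum_of_fintype]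
      _ ≤ ((gasMid G l pos 0)ᶜ).ncard := by
          refine Set.ncard_le_ncard ?_ (Set.toFinite _)
          refine Set.iUnion_subset fun i => ?_
          rintro _ ⟨u, hu, rfl⟩ ⟨h0, h1⟩
          exact hu.elim (fun h => h0 i (h.map (H i).hom)) (fun h => h1 i (h.map (H i).hom))
end

section
/- Let l and k be positive integers and let G be a finite simple graph containing k pairwise vertex-disjoint subgraphs each isomorphic to the path P_{2l+2} on 2l+2 vertices. Then k cleaners with l-visibility have a strategy such that at some point during the graph cleaning process on G at least k·(2l+2) vertices are clean. -/
open Classical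

theorem inSight_comm {V : Type} {G : SimpleGraph V} {l : ℕ} {u v : V} :
    inSight G l u v ↔ inSight G l v u := by
  rw [inSight, inSight, SimpleGraph.reachable_comm, SimpleGraph.dist_comm]

theorem exists_walk_pathGraph_of_add_eq {n : ℕ} (d : ℕ) (a b : Fin n)
    (h : (a : ℕ) + d = b) : ∃ w : (SimpleGraph.pathGraph n).Walk a b, w.length = d := by
  induction d generalizing a with
  | zero =>
    obtain rfl : a = b := Fin.ext (by simpa using h)
    exact ⟨.nil, rfl⟩
  | succ d ih =>
    have hb := b.isLt
    obtain ⟨w, hw⟩ := ih ⟨a + 1, by omega⟩ (by simp only; omega)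
    exact ⟨.cons (SimpleGraph.pathGraph_adj.2 (Or.inl rfl)) w, by simp [hw]⟩

theorem inSight_of_hom_pathGraph {V : Type} {G : SimpleGraph V} {n l : ℕ}
    (f : SimpleGraph.pathGraph n →g G) {a b : Fin n}
    (hab : (a : ℕ) ≤ b + l) (hba : (b : ℕ) ≤ a + l) : inSight G l (f a) (f b) := by
  wlog h : (a : ℕ) ≤ b generalizing a b
  · exact inSight_comm.1 (this hba hab (by omega))
  obtain ⟨w, hw⟩ := exists_walk_pathGraph_of_add_eq (b - a : ℕ) a b (by omega)
  refine ⟨(w.map f).reachable, (SimpleGraph.dist_le (w.map f)).trans ?_⟩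
  rw [SimpleGraph.Walk.length_map]
  omega

/-- Let `l` and `k` be positive integers and let `G` be a finite
simple graph containing `k` pairwise vertex-disjoint subgraphs each isomorphic to
the path `P_{2l+2}` on `2l + 2` vertices. Then `k` cleaners with `l`-visibility can
reach a state of the cleaning process on `G` with at least `k * (2l + 2)` clean
vertices. -/
theorem cleaners_on_disjoint_paths {V : Type} [Fintype V] (G : SimpleGraph V)
    (l k : ℕ) (hl : 0 < l) (hk : 0 < k) (H : Fin k → G.Subgraph)
    (hdisj : ∀ i j, i ≠ j → Disjoint (H i).verts (H j).verts)
    (hpath : ∀ i, Nonempty ((H i).coe ≃g SimpleGraph.pathGraph (2 * l + 2))) :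
    CanCleanAtLeast G l k (k * (2 * l + 2)) := by
  let f : ∀ i, SimpleGraph.pathGraph (2 * l + 2) →g G :=
    fun i => (H i).hom.comp (hpath i).some.symm.toHom
  have hf_mem : ∀ i a, f i a ∈ (H i).verts := fun i a => ((hpath i).some.symm a).2
  have hf_inj : ∀ i, Function.Injective (f i) := fun i =>
    Subtype.val_injective.comp (hpath i).some.symm.injective
  let F : Fin k × Fin (2 * l + 2) → V := fun x => f x.1 x.2
  have hF : Function.Injective F := by
    rintro ⟨i, a⟩ ⟨j, b⟩ hab
    obtain rfl : i = j := by
      by_contra hij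
      refine Set.disjoint_left.1 (hdisj i j hij) (hf_mem i a) ?_
      rw [show f i a = f j b from hab]
      exact hf_mem j b
    exact congrArg (Prod.mk i) (hf_inj i hab)
  let c : ℕ → Fin (2 * l + 2) :=
    fun t => if t = 0 then ⟨l, by omega⟩ else ⟨l + 1, by omega⟩
  refine ⟨fun t i => f i (c t), fun t i => ?_, 0, Or.inr ?_⟩
  · rcases Nat.eq_zero_or_pos t with rfl | ht
    · exact Or.inr ((f i).map_adj (SimpleGraph.pathGraph_adj.2 (Or.inl (by simp [c]))))
    · exact Or.inl (by simp [c, ht.ne'])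
  have hsub : Set.range F ⊆ (gasMid G l (fun t i => f i (c t)) 0)ᶜ := by
    rintro _ ⟨⟨i, a⟩, rfl⟩ ⟨h0, h1⟩
    have ha := a.isLt
    by_cases hal : (a : ℕ) ≤ 2 * l
    · exact h0 i (inSight_of_hom_pathGraph (f i) (show l ≤ (a : ℕ) + l by omega)
        (show (a : ℕ) ≤ l + l by omega))
    · exact h1 i (inSight_of_hom_pathGraph (f i) (show l + 1 ≤ (a : ℕ) + l by omega)
        (show (a : ℕ) ≤ l + 1 + l by omega))
  calc k * (2 * l + 2) = (Set.range F).ncard := by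
        rw [← Set.image_univ, Set.ncard_image_of_injective _ hF, Set.ncard_univ]
        simp
    _ ≤ _ := Set.ncard_le_ncard hsub
end

section
/- Let k be a positive integer and l a positive integer. If G is a finite simple graph with minimum degree δ(G) ≥ k and girth at least 2l + 4, then cop'_l(G) ≥ k; that is, at least k cleaners with l-visibility are needed to clean G of all gas. -/
open Classical

namespace SimpleGraph

variable {V : Type} {G : SimpleGraph V} {l : ℕ}

/-- In a graph of girth at least `2 * l + 4`, two distinct neighbours of `v` are not joined by a
short walk avoiding `v`. -/
lemma Walk.le_length_of_notMem_support (hgirth : (2 * l + 4 : ℕ∞) ≤ G.egirth) {v w₁ w₂ : V}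
    (h₁ : G.Adj v w₁) (h₂ : G.Adj v w₂) (hne : w₁ ≠ w₂) (p : G.Walk w₁ w₂)
    (hv : v ∉ p.support) : 2 * l + 2 ≤ p.length := by
  have hvb : v ∉ p.bypass.support := fun h => hv (p.support_bypass_subset_support h)
  have hcycle : (Walk.cons h₂.symm (Walk.cons h₁ p.bypass)).IsCycle := by
    rw [Walk.cons_isCycle_iff]
    refine ⟨p.bypass_isPath.cons hvb, ?_⟩
    rw [Walk.edges_cons, List.mem_cons, not_or]
    refine ⟨fun h => ?_, fun h => hvb (Walk.snd_mem_support_of_mem_edges _ h)⟩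
    rw [Sym2.eq_swap, Sym2.congr_right] at h
    exact hne h.symm
  have hlen := le_egirth.1 hgirth _ _ hcycle
  have hle := p.length_bypass_le_length
  simp only [Walk.length_cons] at hlen
  norm_cast at hlen
  omega

/-- A vertex `w ≠ v` within distance `n` of `c` is joined to `c` by a walk of length at most `n`
avoiding `v`, provided that `v` is at distance at least `n` from `c`. -/
lemma Reachable.exists_walk_notMem_support {n : ℕ} {c v w : V} (hne : w ≠ v)
    (hr : G.Reachable c w) (hw : G.dist c w ≤ n) (hv : G.Reachable c v → n ≤ G.dist c v) :
    ∃ p : G.Walk w c, p.length ≤ n ∧ v ∉ p.support := by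
  obtain ⟨p, hp⟩ := hr.symm.exists_walk_length_eq_dist
  rw [dist_comm] at hp
  refine ⟨p, hp.trans_le hw, fun hmem => ?_⟩
  have hsum := congrArg Walk.length (p.take_spec hmem)
  rw [Walk.length_append] at hsum
  have hdist := dist_le (p.dropUntil v hmem).reverse
  rw [Walk.length_reverse] at hdist
  have hn := hv (p.dropUntil v hmem).reverse.reachable
  exact hne (Walk.eq_of_length_eq_zero (p := p.takeUntil v hmem) (by omega))

lemma eq_of_walks_notMem_support (hgirth : (2 * l + 4 : ℕ∞) ≤ G.egirth) {v w₁ w₂ a b : V}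
    (h₁ : G.Adj v w₁) (h₂ : G.Adj v w₂) (hab : a = b ∨ G.Adj a b)
    (hp : ∃ p : G.Walk w₁ a, p.length ≤ l ∧ v ∉ p.support)
    (hq : ∃ q : G.Walk w₂ b, q.length ≤ l ∧ v ∉ q.support) : w₁ = w₂ := by
  by_contra hne
  obtain ⟨p, hpl, hpv⟩ := hp
  obtain ⟨q, hql, hqv⟩ := hq
  rcases hab with rfl | hab
  · have := Walk.le_length_of_notMem_support hgirth h₁ h₂ hne (p.append q.reverse)
      (by simp [Walk.mem_support_append_iff, hpv, hqv])
    simp only [Walk.length_append, Walk.length_reverse] at this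
    omega
  · have hva : v ≠ a := by
      rintro rfl
      exact hpv p.end_mem_support
    have := Walk.le_length_of_notMem_support hgirth h₁ h₂ hne (p.append (.cons hab q.reverse))
      (by simp [Walk.mem_support_append_iff, hpv, hqv, hva])
    simp only [Walk.length_append, Walk.length_cons, Walk.length_reverse] at this
    omega

/-- Around each vertex, a graph of minimum degree at least two and girth at least `2 * l + 4` has
vertices at every distance up to `l + 1`. -/
lemma exists_reachable_dist_eq [Fintype V] [DecidableRel G.Adj]
    (hgirth : (2 * l + 4 : ℕ∞) ≤ G.egirth) (hdeg : 1 < G.minDegree) (x : V) (n : ℕ)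
    (hn : n ≤ l + 1) : ∃ v, G.Reachable x v ∧ G.dist x v = n := by
  induction n with
  | zero => exact ⟨x, .refl x, dist_self⟩
  | succ n ih =>
    obtain ⟨v, hxv, hv⟩ := ih (by omega)
    have hcard : 1 < (G.neighborFinset v).card := hdeg.trans_le (G.minDegree_le_degree v)
    obtain ⟨w₁, hw₁, w₂, hw₂, hne⟩ := Finset.one_lt_card.1 hcard
    rw [mem_neighborFinset] at hw₁ hw₂
    by_contra! hcon
    have hwalk (w : V) (hw : G.Adj v w) : ∃ p : G.Walk w x, p.length ≤ l ∧ v ∉ p.support := by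
      have hxw := hxv.trans hw.reachable
      have hdist := hcon w hxw
      obtain ⟨r, hr⟩ := hxv.exists_walk_length_eq_dist
      have hle := dist_le (r.concat hw)
      rw [Walk.length_concat] at hle
      obtain ⟨p, hp, hpv⟩ := hxw.exists_walk_notMem_support (n := n) hw.ne' (by omega)
        fun _ => hv.ge
      exact ⟨p, by omega, hpv⟩
    exact hne (eq_of_walks_notMem_support hgirth hw₁ hw₂ (.inl rfl) (hwalk w₁ hw₁) (hwalk w₂ hw₂))

end SimpleGraph

section Evasion

variable {V : Type} {G : SimpleGraph V} {l m : ℕ}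

/-- Gas at a vertex unseen by the cleaners can spread to a neighbour that remains unseen after
the next move. -/
lemma exists_adj_mem_unseen [Fintype V] [DecidableRel G.Adj]
    (hgirth : (2 * l + 4 : ℕ∞) ≤ G.egirth) (hdeg : m < G.minDegree) {P Q : Fin m → V}
    (hPQ : ∀ i, Q i = P i ∨ G.Adj (P i) (Q i)) {v : V} (hv : v ∈ unseen G l P) :
    ∃ w, G.Adj v w ∧ w ∈ unseen G l P ∧ w ∈ unseen G l Q := by
  by_contra! hcon
  have hseen (w : V) (hw : G.Adj v w) : ∃ i, inSight G l (P i) w ∨ inSight G l (Q i) w := by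
    by_contra! h
    exact hcon w hw (fun i => (h i).1) fun i => (h i).2
  have hwalk (w : G.neighborSet v) : ∃ i c, (c = P i ∨ c = Q i) ∧
      ∃ p : G.Walk w.1 c, p.length ≤ l ∧ v ∉ p.support := by
    obtain ⟨w, hw : G.Adj v w⟩ := w
    obtain ⟨i, h | h⟩ := hseen w hw
    · refine ⟨i, P i, .inl rfl, h.1.exists_walk_notMem_support hw.ne' h.2 fun hr => ?_⟩
      by_contra hlt
      exact hv i ⟨hr, by omega⟩
    · refine ⟨i, Q i, .inr rfl, h.1.exists_walk_notMem_support hw.ne' h.2 fun hr => ?_⟩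
      by_contra! hlt
      obtain ⟨r, hr'⟩ := hr.exists_walk_length_eq_dist
      rcases hPQ i with heq | hadj
      · rw [heq] at hr hlt
        exact hv i ⟨hr, by omega⟩
      · have hle := SimpleGraph.dist_le (SimpleGraph.Walk.cons hadj r)
        rw [SimpleGraph.Walk.length_cons] at hle
        exact hv i ⟨hadj.reachable.trans hr, by omega⟩
  choose f c hc hp using hwalk
  have hcard : Fintype.card (Fin m) < Fintype.card (G.neighborSet v) := by
    rw [Fintype.card_fin, G.card_neighborSet_eq_degree]
    exact hdeg.trans_le (G.minDegree_le_degree v)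
  obtain ⟨w₁, w₂, hne, hf⟩ := Fintype.exists_ne_map_eq_of_card_lt f hcard
  have hab : c w₁ = c w₂ ∨ G.Adj (c w₁) (c w₂) := by
    have h₁ := hc w₁
    have h₂ := hc w₂
    have h := hPQ (f w₁)
    rw [← hf] at h₂
    grind [SimpleGraph.adj_comm]
  exact hne (Subtype.ext
    (SimpleGraph.eq_of_walks_notMem_support hgirth w₁.2 w₂.2 hab (hp w₁) (hp w₂)))

/-- Fewer than `δ(G)` cleaners never see the whole graph: gas evades them while they walk to
their positions from a common vertex. -/
lemma unseen_nonempty [Fintype V] [Nonempty V] [DecidableRel G.Adj]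
    (hgirth : (2 * l + 4 : ℕ∞) ≤ G.egirth) (hdeg : m < G.minDegree) (P : Fin m → V) :
    (unseen G l P).Nonempty := by
  obtain ⟨x⟩ := ‹Nonempty V›
  rcases Nat.eq_zero_or_pos m with rfl | hm
  · exact ⟨x, fun i => i.elim0⟩
  have hstart (i : Fin m) : ∃ (y : V) (_ : G.Walk y (P i)), y = x ∨ ¬ G.Reachable x y := by
    by_cases h : G.Reachable x (P i)
    · exact ⟨x, h.some, .inl rfl⟩
    · exact ⟨P i, .nil, .inr h⟩
  choose y p hy using hstart
  have hgas (t : ℕ) : (unseen G l fun i => (p i).getVert t).Nonempty := by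
    induction t with
    | zero =>
      obtain ⟨v, hxv, hv⟩ :=
        SimpleGraph.exists_reachable_dist_eq hgirth (by omega) x (l + 1) le_rfl
      refine ⟨v, fun i hi => ?_⟩
      simp only [SimpleGraph.Walk.getVert_zero] at hi
      rcases hy i with h | h
      · rw [h] at hi
        have := hi.2
        omega
      · exact h (hxv.trans hi.1.symm)
    | succ t ih =>
      obtain ⟨v, hv⟩ := ih
      have hmove (i : Fin m) : (p i).getVert (t + 1) = (p i).getVert t ∨
          G.Adj ((p i).getVert t) ((p i).getVert (t + 1)) := by
        rcases lt_or_ge t (p i).length with h | h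
        · exact .inr ((p i).adj_getVert_succ h)
        · exact .inl (((p i).getVert_of_length_le (h.trans t.le_succ)).trans
            ((p i).getVert_of_length_le h).symm)
      obtain ⟨w, -, -, hw⟩ := exists_adj_mem_unseen hgirth hdeg hmove hv
      exact ⟨w, hw⟩
  have hend (i : Fin m) : (p i).getVert (∑ j, (p j).length) = P i :=
    (p i).getVert_of_length_le
      (Finset.single_le_sum (f := fun j => (p j).length) (fun _ _ => Nat.zero_le _)
        (Finset.mem_univ i))
  simpa only [hend] using hgas (∑ j, (p j).length)

lemma gasMid_nonempty [Fintype V] [Nonempty V] [DecidableRel G.Adj]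
    (hgirth : (2 * l + 4 : ℕ∞) ≤ G.egirth) (hdeg : m < G.minDegree) {pos : ℕ → Fin m → V}
    (hpos : ValidMoves G pos) (t : ℕ) : (gasMid G l pos t).Nonempty := by
  induction t with
  | zero =>
    obtain ⟨v, hv⟩ := unseen_nonempty (l := l) hgirth hdeg (pos 0)
    obtain ⟨w, -, hw, hw'⟩ := exists_adj_mem_unseen hgirth hdeg (hpos 0) hv
    exact ⟨w, hw, hw'⟩
  | succ t ih =>
    obtain ⟨v, hv⟩ := ih
    obtain ⟨w, hvw, hw, hw'⟩ := exists_adj_mem_unseen hgirth hdeg (hpos (t + 1)) hv.2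
    exact ⟨w, .inr ⟨hw, v, hv, hvw⟩, hw'⟩

lemma not_canCleanAll [Fintype V] [Nonempty V] [DecidableRel G.Adj]
    (hgirth : (2 * l + 4 : ℕ∞) ≤ G.egirth) (hdeg : m < G.minDegree) : ¬ CanCleanAll G l m := by
  rintro ⟨pos, hpos, t, h⟩
  have hmid := gasMid_nonempty (l := l) hgirth hdeg hpos t
  exact h.elim (hmid.mono Set.inter_subset_left).ne_empty hmid.ne_empty

lemma canCleanAll_card [Fintype V] : CanCleanAll G l (Fintype.card V) := by
  refine ⟨fun _ => (Fintype.equivFin V).symm, fun _ _ => .inl rfl, 0, .inl ?_⟩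
  refine Set.eq_empty_of_forall_notMem fun v hv => hv (Fintype.equivFin V v) ?_
  simp [inSight]

end Evasion

/-- If `G` is a finite simple graph with minimum degree at least
`k ≥ 1` and girth at least `2l + 4` (for a positive integer `l`), then
`cop'_l(G) ≥ k`: at least `k` cleaners with `l`-visibility are needed to clean `G`
of all gas. -/
theorem girth_lower_bound_for_cleaning {V : Type} [Fintype V] (G : SimpleGraph V)
    [DecidableRel G.Adj] (k l : ℕ) (hk : 0 < k) (hl : 0 < l)
    (hdeg : k ≤ G.minDegree) (hgirth : (2 * l + 4 : ℕ∞) ≤ G.egirth) :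
    k ≤ seeNum G l := by
  have hV : Nonempty V := by
    by_contra h
    rw [not_nonempty_iff] at h
    simp at hdeg
    omega
  refine le_csInf ⟨_, canCleanAll_card⟩ fun m hm => ?_
  by_contra! hlt
  exact not_canCleanAll hgirth (hlt.trans_le hdeg) hm
end

section
/- For every finite connected simple graph G and every non-negative integer l, the eventual capture number with l-visibility cops equals the classical cop number: evcapt_l(G) = cop(G). -/
open Classical

/-- Cop positions in the classical (full-information) game: the strategy `σ` may
depend on the whole history of robber positions. -/
def fullPos {V : Type} {k : ℕ} (init : Fin k → V) (σ : List V → Fin k → V)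
    (r : ℕ → V) : ℕ → Fin k → V
  | 0 => init
  | t + 1 => σ (List.ofFn fun j : Fin (t + 1) => r j.1)

/-- `k` cops with unrestricted visibility can guarantee capturing the robber on `G`. -/
def CopsCatch {V : Type} (G : SimpleGraph V) (k : ℕ) : Prop :=
  ∃ (init : Fin k → V) (σ : List V → Fin k → V),
    ∀ r : ℕ → V, LegalRobber G r →
      LegalCopPath G (fullPos init σ r) ∧
      ∃ t i, fullPos init σ r t i = r t ∨ fullPos init σ r (t + 1) i = r t

/-- The classical cop number `cop(G)`. -/
noncomputable def copNum {V : Type} (G : SimpleGraph V) : ℕ :=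
  sInf {k | CopsCatch G k}

/-- The number of vertices in the closed neighbourhood of `v`. -/
noncomputable def closedNbhdCard {V : Type} (G : SimpleGraph V) (v : V) : ℕ :=
  {u | u = v ∨ G.Adj v u}.ncard

/-- The probability that `k` cops standing at positions `P`, each independently
choosing its next vertex uniformly at random from its closed neighbourhood, end up
at positions `Q` after one simultaneous random step. -/
noncomputable def stepWeight {V : Type} (G : SimpleGraph V) {k : ℕ}
    (P Q : Fin k → V) : ℝ :=
  ∏ i, if Q i = P i ∨ G.Adj (P i) (Q i) then (1 : ℝ) / (closedNbhdCard G (P i)) else 0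

/-- A robber strategy against randomly moving cops: a function assigning to each
(nonempty) history of cop position-tuples the robber's current position, so that the
robber reacts with full knowledge of all positions.  It is legal if after each new
cop move the robber stays put or moves to an adjacent vertex. -/
def LegalRobberStrat {V : Type} (G : SimpleGraph V) {k : ℕ}
    (ρ : List (Fin k → V) → V) : Prop :=
  ∀ (h : List (Fin k → V)) (Q : Fin k → V), h ≠ [] →
    ρ (h ++ [Q]) = ρ h ∨ G.Adj (ρ h) (ρ (h ++ [Q]))

/-- Given a `hit` relation (between a cop's vertex and the robber's vertex), the
cops at positions `P`, arrived at after the history `prev`, hit the robber playing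
the strategy `ρ` right now: either some cop hits the robber's position after the
robber's answering move, or some cop has just moved so as to hit the robber's
previous position. -/
def HitNow {V : Type} (hit : V → V → Prop) {k : ℕ} (ρ : List (Fin k → V) → V)
    (prev : List (Fin k → V)) (P : Fin k → V) : Prop :=
  (∃ i, hit (P i) (ρ (prev ++ [P]))) ∨ (prev ≠ [] ∧ ∃ i, hit (P i) (ρ prev))

/-- The probability that randomly moving cops, currently at positions `P` reached
via the history `prev`, fail to hit the robber playing strategy `ρ` within the next
`n` random steps. -/
noncomputable def survProb {V : Type} [Fintype V] (G : SimpleGraph V)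
    (hit : V → V → Prop) {k : ℕ} (ρ : List (Fin k → V) → V) :
    ℕ → List (Fin k → V) → (Fin k → V) → ℝ
  | 0, prev, P => if HitNow hit ρ prev P then 0 else 1
  | n + 1, prev, P =>
    if HitNow hit ρ prev P then 0
    else ∑ Q : Fin k → V, stepWeight G P Q * survProb G hit ρ n (prev ++ [P]) Q

/-- `k` cops moving uniformly at random hit the robber (in the sense of the relation
`hit`) with probability `1`, whatever legal strategy the robber uses: for suitable
initial positions, the probability of surviving `n` steps tends to `0`. -/
def AlmostSurelyHits {V : Type} [Fintype V] (G : SimpleGraph V)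
    (hit : V → V → Prop) (k : ℕ) : Prop :=
  ∃ init : Fin k → V, ∀ ρ : List (Fin k → V) → V, LegalRobberStrat G ρ →
    Filter.Tendsto (fun n => survProb G hit ρ n [] init) Filter.atTop (nhds 0)

/-- The eventual capture number `evcapt_l(G)`: the minimum number of `l`-visibility
cops, each moving uniformly at random over its closed neighbourhood at every turn,
that eventually occupy the robber's vertex with probability `1`.  (As capture means
occupying the robber's vertex, the visibility `l` plays no role.) -/
noncomputable def evCaptureNum {V : Type} [Fintype V] (G : SimpleGraph V)
    (l : ℕ) : ℕ :=
  sInf {k | AlmostSurelyHits G (fun c rv => c = rv) k}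

/-- The eventual seeing number `evcapt'_l(G)`: the minimum number of `l`-visibility
cops, each moving uniformly at random over its closed neighbourhood at every turn,
that eventually come within distance `l` of the robber with probability `1`. -/
noncomputable def evSeeNum {V : Type} [Fintype V] (G : SimpleGraph V) (l : ℕ) : ℕ :=
  sInf {k | AlmostSurelyHits G (inSight G l) k}

section CopsAndRobbers

variable {V : Type} {k : ℕ}

/-- Some cop occupies the vertex `v`. -/
def Caught (P : Fin k → V) (v : V) : Prop := ∃ i, P i = v

/-- Every cop stays put or moves to an adjacent vertex. -/
def CopStep (G : SimpleGraph V) (P Q : Fin k → V) : Prop :=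
  ∀ i, Q i = P i ∨ G.Adj (P i) (Q i)

/-- The cops at `P`, who are to move, can catch a robber at `v` within `n` cop moves. -/
def CopsWinIn (G : SimpleGraph V) : ℕ → (Fin k → V) → V → Prop
  | 0, P, v => Caught P v
  | n + 1, P, v => Caught P v ∨ ∃ Q, CopStep G P Q ∧
      (Caught Q v ∨ ∀ v', (v' = v ∨ G.Adj v v') → CopsWinIn G n Q v')

/-- The cops at `P`, who are to move, can catch a robber at `v`. -/
def CopsWin (G : SimpleGraph V) (P : Fin k → V) (v : V) : Prop :=
  ∃ n, CopsWinIn G n P v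

lemma CopsWinIn.succ {G : SimpleGraph V} {n : ℕ} {P : Fin k → V} {v : V}
    (h : CopsWinIn G n P v) : CopsWinIn G (n + 1) P v := by
  induction n generalizing P v with
  | zero => exact Or.inl h
  | succ n ih =>
    rcases h with h | ⟨Q, hQ, h | h⟩
    · exact Or.inl h
    · exact Or.inr ⟨Q, hQ, Or.inl h⟩
    · exact Or.inr ⟨Q, hQ, Or.inr fun v' hv' => ih (h v' hv')⟩

lemma CopsWinIn.mono {G : SimpleGraph V} {m n : ℕ} (hmn : m ≤ n) {P : Fin k → V} {v : V}
    (h : CopsWinIn G m P v) : CopsWinIn G n P v := by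
  induction hmn with
  | refl => exact h
  | step _ ih => exact ih.succ

lemma CopsWin.of_caught {G : SimpleGraph V} {P : Fin k → V} {v : V} (h : Caught P v) :
    CopsWin G P v := ⟨0, h⟩

lemma CopsWin.of_step_caught {G : SimpleGraph V} {P Q : Fin k → V} {v : V}
    (hPQ : CopStep G P Q) (h : Caught Q v) : CopsWin G P v :=
  ⟨1, Or.inr ⟨Q, hPQ, Or.inl h⟩⟩

lemma exists_uniform_copsWinIn {ι : Type*} [Finite ι] {G : SimpleGraph V}
    {P : ι → Fin k → V} {v : ι → V} (h : ∀ a, CopsWin G (P a) (v a)) :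
    ∃ n, ∀ a, CopsWinIn G n (P a) (v a) := by
  cases nonempty_fintype ι
  choose f hf using h
  exact ⟨Finset.univ.sup f, fun a => (hf a).mono (Finset.le_sup (Finset.mem_univ a))⟩

lemma CopsWin.of_step [Finite V] {G : SimpleGraph V} {P Q : Fin k → V} {v : V}
    (hPQ : CopStep G P Q) (h : ∀ v', (v' = v ∨ G.Adj v v') → CopsWin G Q v') :
    CopsWin G P v := by
  obtain ⟨n, hn⟩ := exists_uniform_copsWinIn
    (ι := {v' // v' = v ∨ G.Adj v v'}) (P := fun _ => Q) (v := Subtype.val)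
    fun a => h a.1 a.2
  exact ⟨n + 1, Or.inr ⟨Q, hPQ, Or.inr fun v' hv' => hn ⟨v', hv'⟩⟩⟩

/-- The robber has a memoryless reaction to the cops' moves that stays in positions
not won by the cops whenever possible. -/
lemma exists_evasion (G : SimpleGraph V) :
    ∃ f : (Fin k → V) → V → V, (∀ Q v, f Q v = v ∨ G.Adj v (f Q v)) ∧
      ∀ Q v, (∃ u, (u = v ∨ G.Adj v u) ∧ ¬ CopsWin G Q u) → ¬ CopsWin G Q (f Q v) := by
  have H : ∀ (Q : Fin k → V) (v : V), ∃ v', (v' = v ∨ G.Adj v v') ∧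
      ((∃ u, (u = v ∨ G.Adj v u) ∧ ¬ CopsWin G Q u) → ¬ CopsWin G Q v') := by
    intro Q v
    by_cases h : ∃ u, (u = v ∨ G.Adj v u) ∧ ¬ CopsWin G Q u
    · obtain ⟨u, hu, hw⟩ := h
      exact ⟨u, hu, fun _ => hw⟩
    · exact ⟨v, Or.inl rfl, fun h' => absurd h' h⟩
  choose f hf hf' using H
  exact ⟨f, hf, hf'⟩

lemma not_copsWin_step [Finite V] {G : SimpleGraph V} {P Q : Fin k → V} {v : V}
    (h : ¬ CopsWin G P v) (hPQ : CopStep G P Q) :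
    ∃ u, (u = v ∨ G.Adj v u) ∧ ¬ CopsWin G Q u := by
  by_contra! hc
  exact h (.of_step hPQ hc)

lemma fullPos_succ_eq (init : Fin k → V) (σ : List V → Fin k → V) (r : ℕ → V) (t : ℕ) :
    fullPos init σ r (t + 1) = σ (List.ofFn fun j : Fin (t + 1) => r j.1) := rfl

lemma CopsCatch.exists_copsWin [Finite V] {G : SimpleGraph V} (h : CopsCatch G k) :
    ∃ init : Fin k → V, ∀ v, CopsWin G init v := by
  obtain ⟨init, σ, hσ⟩ := h
  refine ⟨init, ?_⟩
  by_contra! hc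
  obtain ⟨v₀, hv₀⟩ := hc
  obtain ⟨f, hf, hf'⟩ := exists_evasion (k := k) G
  let s : ℕ → List V × V := fun t =>
    Nat.rec ([v₀], v₀) (fun _ p => (p.1 ++ [f (σ p.1) p.2], f (σ p.1) p.2)) t
  have s_succ : ∀ t, s (t + 1) = ((s t).1 ++ [f (σ (s t).1) (s t).2], f (σ (s t).1) (s t).2) :=
    fun _ => rfl
  let r : ℕ → V := fun t => (s t).2
  have hist : ∀ t, (s t).1 = List.ofFn fun j : Fin (t + 1) => r j.1 := by
    intro t
    induction t with
    | zero => simp [s, r]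
    | succ t ih =>
      rw [List.ofFn_succ', List.concat_eq_append]
      have : (s (t + 1)).1 = (s t).1 ++ [r (t + 1)] := rfl
      rw [this, ih]
      simp
  have r_succ : ∀ t, r (t + 1) = f (fullPos init σ r (t + 1)) (r t) := by
    intro t
    rw [fullPos_succ_eq, ← hist]
  obtain ⟨legal, t, i, hcatch⟩ := hσ r fun t => by rw [r_succ]; exact hf _ _
  have evade : ∀ t, ¬ CopsWin G (fullPos init σ r t) (r t) := by
    intro t
    induction t with
    | zero => exact hv₀
    | succ t ih =>
      rw [r_succ]
      exact hf' _ _ (not_copsWin_step ih (legal t))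
  rcases hcatch with hcatch | hcatch
  · exact evade t (.of_caught ⟨i, hcatch⟩)
  · exact evade t (.of_step_caught (legal t) ⟨i, hcatch⟩)

lemma exists_pursuit (G : SimpleGraph V) :
    ∃ g : (Fin k → V) → V → Fin k → V, (∀ P v, CopStep G P (g P v)) ∧
      ∀ P v n, CopsWinIn G (n + 1) P v → Caught P v ∨ Caught (g P v) v ∨
        ∀ v', (v' = v ∨ G.Adj v v') → CopsWinIn G n (g P v) v' := by
  have H : ∀ (P : Fin k → V) (v : V), ∃ Q, CopStep G P Q ∧
      ∀ n, CopsWinIn G (n + 1) P v → Caught P v ∨ Caught Q v ∨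
        ∀ v', (v' = v ∨ G.Adj v v') → CopsWinIn G n Q v' := by
    intro P v
    by_cases h : ∃ n, CopsWinIn G (n + 1) P v
    · rcases Nat.find_spec h with hP | ⟨Q, hQ, hQ'⟩
      · exact ⟨P, fun _ => Or.inl rfl, fun _ _ => Or.inl hP⟩
      · refine ⟨Q, hQ, fun n hn => Or.inr (hQ'.imp_right fun hw v' hv' => ?_)⟩
        exact (hw v' hv').mono (Nat.find_min' h hn)
    · exact ⟨P, fun _ => Or.inl rfl, fun n hn => absurd ⟨n, hn⟩ h⟩
  choose g hg hg' using H
  exact ⟨g, hg, hg'⟩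

lemma copsCatch_of_copsWin {G : SimpleGraph V} {init : Fin k → V}
    (h : ∀ v, CopsWin G init v) : CopsCatch G k := by
  obtain ⟨g, hg, hg'⟩ := exists_pursuit (k := k) G
  refine ⟨init, fun l => l.foldl g init, fun r hr => ?_⟩
  set p := fullPos init (fun l => l.foldl g init) r with hp
  have p_succ : ∀ t, p (t + 1) = g (p t) (r t) := by
    intro t
    cases t with
    | zero => simp [hp, fullPos]
    | succ t =>
      rw [hp, fullPos_succ_eq, List.ofFn_succ', List.concat_eq_append, List.foldl_append]
      rfl
  refine ⟨fun t => by rw [p_succ]; exact hg _ _, ?_⟩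
  have key : ∀ n t, CopsWinIn G n (p t) (r t) → ∃ t i, p t i = r t ∨ p (t + 1) i = r t := by
    intro n
    induction n with
    | zero => exact fun t ⟨i, hi⟩ => ⟨t, i, Or.inl hi⟩
    | succ n ih =>
      intro t ht
      rcases hg' _ _ _ ht with ⟨i, hi⟩ | ⟨i, hi⟩ | hw
      · exact ⟨t, i, Or.inl hi⟩
      · exact ⟨t, i, Or.inr (by rw [p_succ, hi])⟩
      · exact ih (t + 1) (by rw [p_succ]; exact hw _ (hr t))
  obtain ⟨n, hn⟩ := h (r 0)
  exact key n 0 hn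

lemma copsCatch_iff_exists_copsWin [Finite V] {G : SimpleGraph V} :
    CopsCatch G k ↔ ∃ init : Fin k → V, ∀ v, CopsWin G init v :=
  ⟨CopsCatch.exists_copsWin, fun ⟨_, h⟩ => copsCatch_of_copsWin h⟩

lemma copsWin_of_connected [Finite V] {G : SimpleGraph V} (hG : G.Connected)
    {init : Fin k → V} (h : ∀ v, CopsWin G init v) (P : Fin k → V) (v : V) :
    CopsWin G P v := by
  have key : ∀ (n : ℕ) (P : Fin k → V), (∀ i, ∃ p : G.Walk (P i) (init i), p.length ≤ n) →
      ∀ v, CopsWin G P v := by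
    intro n
    induction n with
    | zero =>
      intro P hP
      have : P = init := funext fun i => by
        obtain ⟨p, hp⟩ := hP i
        exact p.eq_of_length_eq_zero (Nat.le_zero.mp hp)
      rwa [this]
    | succ n ih =>
      intro P hP v
      have H : ∀ i, ∃ u, (u = P i ∨ G.Adj (P i) u) ∧
          ∃ q : G.Walk u (init i), q.length ≤ n := by
        intro i
        obtain ⟨p, hp⟩ := hP i
        generalize P i = a at p
        cases p with
        | nil => exact ⟨_, Or.inl rfl, .nil, Nat.zero_le n⟩
        | cons hadj q => exact ⟨_, Or.inr hadj, q, by simpa using hp⟩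
      choose Q hQ hQ' using H
      exact .of_step hQ fun v' _ => ih Q hQ' v'
  let p i := (hG.preconnected (P i) (init i)).some
  exact key (Finset.univ.sup fun i => (p i).length) P
    (fun i => ⟨p i, Finset.le_sup (f := fun i => (p i).length) (Finset.mem_univ i)⟩) v

lemma stepWeight_nonneg (G : SimpleGraph V) (P Q : Fin k → V) : 0 ≤ stepWeight G P Q :=
  Finset.prod_nonneg fun i _ => by split_ifs <;> positivity

lemma stepWeight_eq_zero {G : SimpleGraph V} {P Q : Fin k → V} (h : ¬ CopStep G P Q) :
    stepWeight G P Q = 0 := by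
  obtain ⟨i, hi⟩ := not_forall.mp h
  exact Finset.prod_eq_zero (Finset.mem_univ i) (if_neg hi)

section Random

variable [Fintype V]

lemma closedNbhdCard_pos (G : SimpleGraph V) (v : V) : 0 < closedNbhdCard G v :=
  (Set.ncard_pos (Set.toFinite _)).mpr ⟨v, Or.inl rfl⟩

lemma closedNbhdCard_le (G : SimpleGraph V) (v : V) : closedNbhdCard G v ≤ Fintype.card V := by
  rw [← Nat.card_eq_fintype_card]
  exact Set.ncard_le_card _

lemma le_stepWeight {G : SimpleGraph V} {P Q : Fin k → V} (h : CopStep G P Q) :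
    (1 / (Fintype.card V : ℝ)) ^ k ≤ stepWeight G P Q := by
  have : (1 / (Fintype.card V : ℝ)) ^ k = ∏ _i : Fin k, 1 / (Fintype.card V : ℝ) := by simp
  rw [this]
  refine Finset.prod_le_prod (fun _ _ => by positivity) fun i _ => ?_
  rw [if_pos (h i)]
  exact one_div_le_one_div_of_le (by exact_mod_cast closedNbhdCard_pos G (P i))
    (by exact_mod_cast closedNbhdCard_le G (P i))

lemma sum_stepWeight (G : SimpleGraph V) (P : Fin k → V) : ∑ Q, stepWeight G P Q = 1 := by
  have H : ∀ i, ∑ v : V, (if v = P i ∨ G.Adj (P i) v then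
      (1 : ℝ) / (closedNbhdCard G (P i)) else 0) = 1 := by
    intro i
    have hc : (closedNbhdCard G (P i) : ℝ) ≠ 0 := by
      exact_mod_cast (closedNbhdCard_pos G (P i)).ne'
    rw [← Finset.sum_filter, Finset.sum_const, nsmul_eq_mul]
    have : (Finset.univ.filter fun v => v = P i ∨ G.Adj (P i) v).card =
        closedNbhdCard G (P i) := by
      rw [closedNbhdCard, ← Set.ncard_coe_finset]
      simp
    rw [this, mul_one_div_cancel hc]
  have := Finset.prod_univ_sum (fun _ : Fin k => (Finset.univ : Finset V))
    fun i v => if v = P i ∨ G.Adj (P i) v then (1 : ℝ) / (closedNbhdCard G (P i)) else 0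
  rw [Finset.prod_congr rfl fun i _ => H i, Finset.prod_const_one, Fintype.piFinset_univ] at this
  exact this.symm

variable {G : SimpleGraph V} {hit : V → V → Prop} {ρ : List (Fin k → V) → V}

lemma survProb_of_hitNow {prev : List (Fin k → V)} {P : Fin k → V}
    (h : HitNow hit ρ prev P) (n : ℕ) : survProb G hit ρ n prev P = 0 := by
  cases n <;> simp [survProb, h]

lemma survProb_succ {prev : List (Fin k → V)} {P : Fin k → V}
    (h : ¬ HitNow hit ρ prev P) (n : ℕ) : survProb G hit ρ (n + 1) prev P =
      ∑ Q, stepWeight G P Q * survProb G hit ρ n (prev ++ [P]) Q := by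
  rw [survProb, if_neg h]

lemma survProb_nonneg (n : ℕ) (prev : List (Fin k → V)) (P : Fin k → V) :
    0 ≤ survProb G hit ρ n prev P := by
  induction n generalizing prev P with
  | zero => rw [survProb]; split_ifs <;> norm_num
  | succ n ih =>
    by_cases h : HitNow hit ρ prev P
    · rw [survProb_of_hitNow h]
    · rw [survProb_succ h]
      exact Finset.sum_nonneg fun Q _ => mul_nonneg (stepWeight_nonneg G P Q) (ih _ _)

lemma survProb_zero_le_one (prev : List (Fin k → V)) (P : Fin k → V) :
    survProb G hit ρ 0 prev P ≤ 1 := by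
  rw [survProb]; split_ifs <;> norm_num

lemma survProb_add_le {c : ℝ} (hc : 0 ≤ c) {m : ℕ}
    (hm : ∀ prev P, survProb G hit ρ m prev P ≤ c) (n : ℕ) (prev : List (Fin k → V))
    (P : Fin k → V) : survProb G hit ρ (n + m) prev P ≤ c := by
  induction n generalizing prev P with
  | zero => simpa using hm prev P
  | succ n ih =>
    by_cases h : HitNow hit ρ prev P
    · rwa [survProb_of_hitNow h]
    · rw [Nat.succ_add, survProb_succ h]
      calc _ ≤ ∑ Q, stepWeight G P Q * c := Finset.sum_le_sum fun Q _ =>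
            mul_le_mul_of_nonneg_left (ih _ _) (stepWeight_nonneg G P Q)
        _ = c := by rw [← Finset.sum_mul, sum_stepWeight, one_mul]

/-- Each legal cop move has probability at least `δ`, so a win in `n` moves is played by
the random cops with probability at least `δ ^ n`. -/
lemma survProb_add_le_of_copsWinIn (hρ : LegalRobberStrat G ρ) {δ : ℝ} (hδ : 0 ≤ δ)
    (hδ₁ : δ ≤ 1) (hstep : ∀ P Q : Fin k → V, CopStep G P Q → δ ≤ stepWeight G P Q)
    {c : ℝ} (hc : 0 ≤ c) {m : ℕ}
    (hm : ∀ prev P, survProb G (fun c rv => c = rv) ρ m prev P ≤ c) (n : ℕ)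
    (prev : List (Fin k → V)) (P : Fin k → V) (hw : CopsWinIn G n P (ρ (prev ++ [P]))) :
    survProb G (fun c rv => c = rv) ρ (n + m) prev P ≤ (1 - δ ^ n) * c := by
  have bound_nonneg : ∀ n, 0 ≤ (1 - δ ^ n) * c := fun n =>
    mul_nonneg (sub_nonneg.mpr (pow_le_one₀ hδ hδ₁)) hc
  induction n generalizing prev P with
  | zero => rw [survProb_of_hitNow (Or.inl hw)]; exact bound_nonneg 0
  | succ n ih =>
    by_cases h : HitNow (fun c rv => c = rv) ρ prev P
    · rw [survProb_of_hitNow h]; exact bound_nonneg _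
    rcases hw with hw | ⟨Q, hQ, hw⟩
    · exact absurd (Or.inl hw) h
    have hne : prev ++ [P] ≠ [] := by simp
    have hQ_le : survProb G (fun c rv => c = rv) ρ (n + m) (prev ++ [P]) Q ≤
        (1 - δ ^ n) * c := by
      rcases hw with hw | hw
      · rw [survProb_of_hitNow (Or.inr ⟨hne, hw⟩)]; exact bound_nonneg n
      · exact ih _ _ (hw _ (hρ _ Q hne))
    rw [Nat.succ_add, survProb_succ h]
    have hle : ∀ R, stepWeight G P R * survProb G (fun c rv => c = rv) ρ (n + m) (prev ++ [P]) R ≤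
        stepWeight G P R * c - if R = Q then stepWeight G P Q * (δ ^ n * c) else 0 := by
      intro R
      split_ifs with hR
      · subst hR
        have := mul_le_mul_of_nonneg_left hQ_le (stepWeight_nonneg G P R)
        linarith
      · rw [sub_zero]
        exact mul_le_mul_of_nonneg_left (survProb_add_le hc hm n _ _) (stepWeight_nonneg G P R)
    have hδQ := mul_le_mul_of_nonneg_right (hstep P Q hQ) (mul_nonneg (pow_nonneg hδ n) hc)
    calc _ ≤ _ := Finset.sum_le_sum fun R _ => hle R
      _ = c - stepWeight G P Q * (δ ^ n * c) := by
        rw [Finset.sum_sub_distrib, ← Finset.sum_mul, sum_stepWeight, one_mul]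
        simp
      _ ≤ (1 - δ ^ (n + 1)) * c := by rw [pow_succ]; linarith

lemma almostSurelyHits_of_copsWin (hG : G.Connected) {init : Fin k → V}
    (h : ∀ v, CopsWin G init v) : AlmostSurelyHits G (fun c rv => c = rv) k := by
  refine ⟨init, fun ρ hρ => ?_⟩
  obtain ⟨N, hN⟩ := exists_uniform_copsWinIn (ι := (Fin k → V) × V) (P := Prod.fst)
    (v := Prod.snd) fun a => copsWin_of_connected hG h a.1 a.2
  have hcard : (1 : ℝ) ≤ Fintype.card V := by
    have := hG.nonempty
    exact_mod_cast Fintype.card_pos (α := V)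
  set δ : ℝ := (1 / (Fintype.card V : ℝ)) ^ k
  have hδ : 0 < δ := by positivity
  have hδ₁ : δ ≤ 1 := pow_le_one₀ (by positivity) (div_le_one_of_le₀ hcard (by positivity))
  have hq : 0 ≤ 1 - δ ^ N := sub_nonneg.mpr (pow_le_one₀ hδ.le hδ₁)
  have hbound : ∀ j prev P,
      survProb G (fun c rv => c = rv) ρ (N * j) prev P ≤ (1 - δ ^ N) ^ j := by
    intro j
    induction j with
    | zero => simpa using survProb_zero_le_one
    | succ j ih =>
      intro prev P
      rw [Nat.mul_succ, add_comm, pow_succ']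
      exact survProb_add_le_of_copsWinIn hρ hδ.le hδ₁ (fun _ _ => le_stepWeight)
        (pow_nonneg hq j) ih N prev P (hN (P, _))
  rw [Metric.tendsto_atTop]
  intro ε hε
  obtain ⟨j, hj⟩ := exists_pow_lt_of_lt_one hε (sub_lt_self 1 (pow_pos hδ N))
  refine ⟨N * j, fun n hn => ?_⟩
  rw [Real.dist_0_eq_abs, abs_of_nonneg (survProb_nonneg _ _ _), ← Nat.sub_add_cancel hn]
  exact (survProb_add_le (pow_nonneg hq j) (hbound j) _ _ _).trans_lt hj

lemma AlmostSurelyHits.exists_copsWin (h : AlmostSurelyHits G (fun c rv => c = rv) k) :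
    ∃ init : Fin k → V, ∀ v, CopsWin G init v := by
  obtain ⟨init, hinit⟩ := h
  refine ⟨init, ?_⟩
  by_contra! hc
  obtain ⟨v₀, hv₀⟩ := hc
  obtain ⟨f, hf, hf'⟩ := exists_evasion (k := k) G
  let ρ : List (Fin k → V) → V := fun l => l.tail.foldl (fun v Q => f Q v) v₀
  have ρ_append : ∀ l Q, l ≠ [] → ρ (l ++ [Q]) = f Q (ρ l) := by
    intro l Q hl
    simp [ρ, List.tail_append_of_ne_nil hl]
  have key : ∀ n prev P, ¬ CopsWin G P (ρ (prev ++ [P])) →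
      (prev ≠ [] → ¬ Caught P (ρ prev)) → 1 ≤ survProb G (fun c rv => c = rv) ρ n prev P := by
    intro n
    induction n with
    | zero =>
      intro prev P hP hprev
      rw [survProb, if_neg]
      rintro (h | ⟨hne, h⟩)
      exacts [hP (.of_caught h), hprev hne h]
    | succ n ih =>
      intro prev P hP hprev
      have hnot : ¬ HitNow (fun c rv => c = rv) ρ prev P := by
        rintro (h | ⟨hne, h⟩)
        exacts [hP (.of_caught h), hprev hne h]
      rw [survProb_succ hnot, ← sum_stepWeight G P]
      refine Finset.sum_le_sum fun Q _ => ?_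
      by_cases hQ : CopStep G P Q
      · refine le_mul_of_one_le_right (stepWeight_nonneg G P Q) (ih _ _ ?_ fun _ hcaught => ?_)
        · rw [ρ_append _ _ (by simp)]
          exact hf' _ _ (not_copsWin_step hP hQ)
        · exact hP (.of_step_caught hQ hcaught)
      · simp [stepWeight_eq_zero hQ]
  have hle := ge_of_tendsto' (hinit ρ fun l Q hl => by rw [ρ_append l Q hl]; exact hf _ _)
    fun n => key n [] init hv₀ fun h => absurd rfl h
  exact absurd hle (by norm_num)

lemma almostSurelyHits_iff_copsCatch (hG : G.Connected) :
    AlmostSurelyHits G (fun c rv => c = rv) k ↔ CopsCatch G k := by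
  rw [copsCatch_iff_exists_copsWin]
  exact ⟨AlmostSurelyHits.exists_copsWin, fun ⟨_, h⟩ => almostSurelyHits_of_copsWin hG h⟩

end Random

end CopsAndRobbers

/-- For every finite connected simple graph `G` and every
non-negative integer `l`, the eventual capture number with `l`-visibility cops
equals the classical cop number: `evcapt_l(G) = cop(G)`. -/
theorem evCaptureNum_eq_copNum {V : Type} [Fintype V] (G : SimpleGraph V)
    (hG : G.Connected) (l : ℕ) :
    evCaptureNum G l = copNum G := by
  simp only [evCaptureNum, copNum, almostSurelyHits_iff_copsCatch hG]
end
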